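/- arXiv:2010.01384 — 4 statements merged into one kernel-verified Lean document; each statement's English description precedes it below -/
import Mathlib

section
/- Let d be a positive integer, let B be a real symmetric positive definite d×d matrix, and let s, y ∈ ℝ^d be vectors with sᵀy > 0 (in particular s ≠ 0, so sᵀBs > 0). Then the matrix B' = B + y yᵀ/(yᵀ s) − (B s)(B s)ᵀ/(sᵀ B s) is symmetric positive definite. -/
open Matrix

/-- Completing the square: subtracting from `x` its `B`-orthogonal projection onto `s`. -/
theorem Matrix.IsSymm.dotProduct_mulVec_sub_smul {n : Type*} [Fintype n]
    {B : Matrix n n ℝ} (hB : B.IsSymm) (s x : n → ℝ) (hs : s ⬝ᵥ B *ᵥ s ≠ 0) :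
    let v := x - ((x ⬝ᵥ B *ᵥ s) / (s ⬝ᵥ B *ᵥ s)) • s
    v ⬝ᵥ B *ᵥ v = x ⬝ᵥ B *ᵥ x - (s ⬝ᵥ B *ᵥ s)⁻¹ * (x ⬝ᵥ B *ᵥ s) ^ 2 := by
  have hsx : s ⬝ᵥ B *ᵥ x = x ⬝ᵥ B *ᵥ s := by
    rw [dotProduct_mulVec, ← mulVec_transpose, hB.eq, dotProduct_comm]
  simp only [mulVec_sub, mulVec_smul, sub_dotProduct, dotProduct_sub, smul_dotProduct,
    dotProduct_smul, smul_eq_mul, hsx]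
  field_simp
  ring

/-- The direct-form BFGS update preserves symmetric positive definiteness:
if `B` is symmetric positive definite and `sᵀy > 0`, then
`B' = B + y yᵀ/(yᵀ s) − (B s)(B s)ᵀ/(sᵀ B s)` is symmetric positive definite. -/
theorem bfgs_direct_update_posDef (d : ℕ) (hd : 0 < d)
    (B : Matrix (Fin d) (Fin d) ℝ) (hB : B.PosDef)
    (s y : Fin d → ℝ) (hsy : 0 < s ⬝ᵥ y) :
    (B + (y ⬝ᵥ s)⁻¹ • Matrix.vecMulVec y y -
      (s ⬝ᵥ B.mulVec s)⁻¹ • Matrix.vecMulVec (B.mulVec s) (B.mulVec s)).PosDef := by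
  have hsymm : B.IsSymm := by simpa [IsHermitian, IsSymm] using hB.isHermitian
  have hpos : ∀ v : Fin d → ℝ, v ≠ 0 → 0 < v ⬝ᵥ B *ᵥ v := fun v hv => by
    simpa using hB.dotProduct_mulVec_pos hv
  have hs : s ≠ 0 := by
    rintro rfl
    simp at hsy
  refine PosDef.of_dotProduct_mulVec_pos ?_ fun x hx => ?_
  · simp [IsHermitian, hsymm.eq, transpose_vecMulVec]
  have hquad : star x ⬝ᵥ ((B + (y ⬝ᵥ s)⁻¹ • vecMulVec y y -
      (s ⬝ᵥ B *ᵥ s)⁻¹ • vecMulVec (B *ᵥ s) (B *ᵥ s)) *ᵥ x) =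
      (x ⬝ᵥ B *ᵥ x - (s ⬝ᵥ B *ᵥ s)⁻¹ * (x ⬝ᵥ B *ᵥ s) ^ 2) +
        (s ⬝ᵥ y)⁻¹ * (x ⬝ᵥ y) ^ 2 := by
    simp only [star_trivial, sub_mulVec, add_mulVec, smul_mulVec, vecMulVec_mulVec,
      dotProduct_sub, dotProduct_add, dotProduct_smul, op_smul_eq_smul, smul_eq_mul,
      dotProduct_comm y, dotProduct_comm (B *ᵥ s) x]
    ring
  rw [hquad, ← hsymm.dotProduct_mulVec_sub_smul s x (hpos s hs).ne']
  set t := (x ⬝ᵥ B *ᵥ s) / (s ⬝ᵥ B *ᵥ s)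
  by_cases hv : x - t • s = 0
  · have hxt : x = t • s := sub_eq_zero.mp hv
    have ht : t ≠ 0 := fun ht => hx (by rw [hxt, ht, zero_smul])
    have hxy : x ⬝ᵥ y ≠ 0 := by
      rw [hxt, smul_dotProduct, smul_eq_mul]
      exact mul_ne_zero ht hsy.ne'
    rw [hv, zero_dotProduct, zero_add]
    positivity
  · have := hpos _ hv
    positivity
end

section
/- Let d be a positive integer, let B be a real symmetric positive definite d×d matrix, and let s, y ∈ ℝ^d with s ≠ 0 and sᵀy > 0. Then the BFGS update B' = B + y yᵀ/(yᵀ s) − (B s)(B s)ᵀ/(sᵀ B s) satisfies det(B') = det(B) · (sᵀy)/(sᵀBs). -/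
open Matrix

/-- The rank-two matrix determinant lemma. -/
theorem Matrix.det_one_add_vecMulVec_add_vecMulVec {n R : Type*} [Fintype n] [DecidableEq n]
    [CommRing R] (u v w z : n → R) :
    (1 + vecMulVec u v + vecMulVec w z).det =
      (1 + v ⬝ᵥ u) * (1 + z ⬝ᵥ w) - (v ⬝ᵥ w) * (z ⬝ᵥ u) := by
  have h : vecMulVec u v + vecMulVec w z = (of ![u, w])ᵀ * of ![v, z] := by
    ext i j
    simp [Matrix.mul_apply, vecMulVec_apply, Fin.sum_univ_two]
  rw [add_assoc, h, det_one_add_mul_comm, det_fin_two]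
  simp [dotProduct, vecMul_transpose, mul_comm]

/-- Determinant identity for the BFGS update:
`det(B') = det(B) · (sᵀy)/(sᵀBs)` where
`B' = B + y yᵀ/(yᵀ s) − (B s)(B s)ᵀ/(sᵀ B s)`. -/
theorem bfgs_update_det (d : ℕ) (hd : 0 < d)
    (B : Matrix (Fin d) (Fin d) ℝ) (hB : B.PosDef)
    (s y : Fin d → ℝ) (hs : s ≠ 0) (hsy : 0 < s ⬝ᵥ y) :
    (B + (y ⬝ᵥ s)⁻¹ • Matrix.vecMulVec y y -
      (s ⬝ᵥ B.mulVec s)⁻¹ • Matrix.vecMulVec (B.mulVec s) (B.mulVec s)).det =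
      B.det * ((s ⬝ᵥ y) / (s ⬝ᵥ B.mulVec s)) := by
  have hq : s ⬝ᵥ B *ᵥ s ≠ 0 := by simpa using (hB.dotProduct_mulVec_pos hs).ne'
  have hc : y ⬝ᵥ s ≠ 0 := by rw [dotProduct_comm]; exact hsy.ne'
  obtain ⟨t, rfl⟩ : ∃ t, B *ᵥ t = y :=
    ⟨B⁻¹ *ᵥ y, by
      rw [mulVec_mulVec, mul_nonsing_inv _ ((isUnit_iff_isUnit_det B).mp hB.isUnit), one_mulVec]⟩
  have hsymm : B *ᵥ s ⬝ᵥ t = B *ᵥ t ⬝ᵥ s := by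
    have hT : Bᵀ = B := by simpa using hB.isHermitian.eq
    rw [dotProduct_comm, dotProduct_mulVec, ← mulVec_transpose, hT]
  have hfactor : B + (B *ᵥ t ⬝ᵥ s)⁻¹ • vecMulVec (B *ᵥ t) (B *ᵥ t) -
      (s ⬝ᵥ B *ᵥ s)⁻¹ • vecMulVec (B *ᵥ s) (B *ᵥ s) =
      B * (1 + vecMulVec ((B *ᵥ t ⬝ᵥ s)⁻¹ • t) (B *ᵥ t) +
        vecMulVec (-(s ⬝ᵥ B *ᵥ s)⁻¹ • s) (B *ᵥ s)) := by
    simp only [mul_add, mul_one, mul_vecMulVec, smul_vecMulVec, mul_smul_comm, neg_smul,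
      neg_vecMulVec, mul_neg, sub_eq_add_neg]
  rw [hfactor, det_mul, det_one_add_vecMulVec_add_vecMulVec]
  simp only [dotProduct_smul, smul_eq_mul, hsymm]
  rw [dotProduct_comm (B *ᵥ s) s, dotProduct_comm s (B *ᵥ t)]
  field_simp
  ring
end

section
/- Let d be a positive integer and let 0 < a ≤ A, δ > 0, 0 < r < 1 be constants. Let H̄ be a real symmetric d×d matrix with a‖x‖² ≤ xᵀH̄x ≤ A‖x‖² for all x ∈ ℝ^d, let s ∈ ℝ^d be nonzero, let y = H̄s, let θ ∈ [0,1], and let γ ∈ [δ, δ + A]. Define ȳ = θ y + (1 − θ) γ s and assume sᵀȳ ≥ r γ ‖s‖². Then (ȳᵀȳ)/(ȳᵀs) ≤ (1/r)(A²/δ + (δ + A) + 2A). -/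
open Matrix

/-- If a symmetric matrix `H` satisfies `0 ≤ xᵀHx ≤ A‖x‖²` for all `x`, with `A > 0`, then
`‖Hs‖² ≤ A sᵀHs`. -/
theorem mulVec_dotProduct_self_le {n : Type*} [Fintype n] {H : Matrix n n ℝ} {A : ℝ}
    (hA : 0 < A) (hH : H.IsSymm) (hnonneg : ∀ x : n → ℝ, 0 ≤ x ⬝ᵥ H *ᵥ x)
    (hle : ∀ x : n → ℝ, x ⬝ᵥ H *ᵥ x ≤ A * (x ⬝ᵥ x)) (s : n → ℝ) :
    (H *ᵥ s) ⬝ᵥ (H *ᵥ s) ≤ A * (s ⬝ᵥ H *ᵥ s) := by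
  have hsymm : s ⬝ᵥ H *ᵥ (H *ᵥ s) = (H *ᵥ s) ⬝ᵥ (H *ᵥ s) := by
    rw [dotProduct_mulVec, ← mulVec_transpose, hH.eq]
  have h := hnonneg (A • s - H *ᵥ s)
  simp only [mulVec_sub, mulVec_smul, sub_dotProduct, dotProduct_sub, smul_dotProduct,
    dotProduct_smul, smul_eq_mul, hsymm] at h
  have hle' := hle (H *ᵥ s)
  exact le_of_mul_le_mul_left (by linarith) hA

/-- Uniform bound on the curvature ratio `ȳᵀȳ/(ȳᵀs)` in damped L-BFGS:
if `a‖x‖² ≤ xᵀH̄x ≤ A‖x‖²` for all `x`, `y = H̄s`, `ȳ = θ y + (1−θ) γ s`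
with `θ ∈ [0,1]`, `γ ∈ [δ, δ+A]`, and `sᵀȳ ≥ r γ ‖s‖²`, then
`(ȳᵀȳ)/(ȳᵀs) ≤ (1/r)(A²/δ + (δ + A) + 2A)`. -/
theorem damped_lbfgs_ratio_bound (d : ℕ) (hd : 0 < d)
    (a A δ r : ℝ) (ha : 0 < a) (haA : a ≤ A) (hδ : 0 < δ) (hr0 : 0 < r) (hr1 : r < 1)
    (Hbar : Matrix (Fin d) (Fin d) ℝ) (hHsymm : Hbar.IsSymm)
    (hHbound : ∀ x : Fin d → ℝ,
      a * (x ⬝ᵥ x) ≤ x ⬝ᵥ Hbar.mulVec x ∧ x ⬝ᵥ Hbar.mulVec x ≤ A * (x ⬝ᵥ x))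
    (s : Fin d → ℝ) (hs : s ≠ 0)
    (y : Fin d → ℝ) (hy : y = Hbar.mulVec s)
    (θ : ℝ) (hθ : θ ∈ Set.Icc (0 : ℝ) 1)
    (γ : ℝ) (hγ : γ ∈ Set.Icc δ (δ + A))
    (ybar : Fin d → ℝ) (hybar : ybar = θ • y + (1 - θ) • (γ • s))
    (hcurv : r * γ * (s ⬝ᵥ s) ≤ s ⬝ᵥ ybar) :
    (ybar ⬝ᵥ ybar) / (ybar ⬝ᵥ s) ≤ (1 / r) * (A ^ 2 / δ + (δ + A) + 2 * A) := by
  have hA : 0 < A := ha.trans_le haA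
  obtain ⟨hθ0, hθ1⟩ := hθ
  obtain ⟨hγ0, hγ1⟩ := hγ
  have hγ : 0 < γ := hδ.trans_le hγ0
  have hnonneg (x : Fin d → ℝ) : 0 ≤ x ⬝ᵥ x := Finset.sum_nonneg fun i _ => mul_self_nonneg (x i)
  have hN : 0 < s ⬝ᵥ s := (hnonneg s).lt_of_ne' (mt dotProduct_self_eq_zero.mp hs)
  have hyy : y ⬝ᵥ y ≤ A * (s ⬝ᵥ y) := by
    rw [hy]
    exact mulVec_dotProduct_self_le hA hHsymm
      (fun x => (mul_nonneg ha.le (hnonneg x)).trans (hHbound x).1) (fun x => (hHbound x).2) s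
  have hsy : s ⬝ᵥ y ≤ A * (s ⬝ᵥ s) := hy ▸ (hHbound s).2
  have hyy' : y ⬝ᵥ y ≤ A ^ 2 * (s ⬝ᵥ s) := by
    nlinarith [mul_le_mul_of_nonneg_left hsy hA.le]
  have hexpand : ybar ⬝ᵥ ybar = θ ^ 2 * (y ⬝ᵥ y) + 2 * (θ * (1 - θ) * γ) * (s ⬝ᵥ y)
      + ((1 - θ) * γ) ^ 2 * (s ⬝ᵥ s) := by
    rw [hybar]
    simp only [add_dotProduct, dotProduct_add, smul_dotProduct, dotProduct_smul, smul_eq_mul,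
      dotProduct_comm y s]
    ring
  have hθ' : 0 ≤ 1 - θ := sub_nonneg.mpr hθ1
  have hmix : θ * A + (1 - θ) * γ ≤ A + γ := by nlinarith
  have hnum : ybar ⬝ᵥ ybar ≤ (A + γ) ^ 2 * (s ⬝ᵥ s) := calc
    ybar ⬝ᵥ ybar ≤ θ ^ 2 * (A ^ 2 * (s ⬝ᵥ s)) + 2 * (θ * (1 - θ) * γ) * (A * (s ⬝ᵥ s))
        + ((1 - θ) * γ) ^ 2 * (s ⬝ᵥ s) := by
      rw [hexpand]
      gcongr
    _ = (θ * A + (1 - θ) * γ) ^ 2 * (s ⬝ᵥ s) := by ring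
    _ ≤ (A + γ) ^ 2 * (s ⬝ᵥ s) := by gcongr
  rw [dotProduct_comm ybar s]
  calc
    (ybar ⬝ᵥ ybar) / (s ⬝ᵥ ybar) ≤ (A + γ) ^ 2 * (s ⬝ᵥ s) / (r * γ * (s ⬝ᵥ s)) := by gcongr
    _ = (1 / r) * (A ^ 2 / γ + γ + 2 * A) := by
      field_simp
      ring
    _ ≤ (1 / r) * (A ^ 2 / δ + (δ + A) + 2 * A) := by gcongr
end

section
/- Let d, M be positive integers and let 0 < a ≤ A, δ > 0, 0 < r < 1, and γ ∈ [δ, δ + A] be constants. Set B₀ = γI (a d×d matrix) and suppose that for i = 0, 1, …, M−1 there are vectors s_i ∈ ℝ^d, s_i ≠ 0, and ȳ_i ∈ ℝ^d satisfying s_iᵀȳ_i ≥ r γ ‖s_i‖² and (ȳ_iᵀȳ_i)/(ȳ_iᵀs_i) ≤ (1/r)(A²/δ + (δ + A) + 2A), and define recursively B_{i+1} = B_i + ȳ_iȳ_iᵀ/(ȳ_iᵀs_i) − (B_is_i)(B_is_i)ᵀ/(s_iᵀB_is_i). Then each B_i is symmetric positive definite, and every eigenvalue μ of B_M satisfies ã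 ≤ μ ≤ Ã, where Ã = d(δ + A) + (M/r)(A²/δ + (δ + A) + 2A) and ã = (r/Ã)^M δ^{d+M} / Ã^{d−1}. -/
open Matrix

namespace Matrix

variable {n : Type*} [Fintype n]

/-- The BFGS update of `B` along the step `s` with gradient difference `y`. -/
noncomputable def bfgsUpdate (B : Matrix n n ℝ) (s y : n → ℝ) : Matrix n n ℝ :=
  B + (y ⬝ᵥ s)⁻¹ • vecMulVec y y - (s ⬝ᵥ B *ᵥ s)⁻¹ • vecMulVec (B *ᵥ s) (B *ᵥ s)

lemma IsHermitian.dotProduct_mulVec_comm {B : Matrix n n ℝ} (hB : B.IsHermitian) (x z : n → ℝ) :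
    x ⬝ᵥ B *ᵥ z = z ⬝ᵥ B *ᵥ x := by
  have hT : Bᵀ = B := by simpa using hB.eq
  rw [dotProduct_mulVec, ← mulVec_transpose, hT, dotProduct_comm]

lemma PosDef.bfgsUpdate {B : Matrix n n ℝ} (hB : B.PosDef) {s y : n → ℝ} (hs : s ≠ 0)
    (hys : 0 < y ⬝ᵥ s) : (B.bfgsUpdate s y).PosDef := by
  have hβ : 0 < s ⬝ᵥ B *ᵥ s := by simpa using hB.dotProduct_mulVec_pos hs
  refine .of_dotProduct_mulVec_pos ?_ fun x hx => ?_
  · have hT : Bᵀ = B := by simpa using hB.isHermitian.eq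
    simp [Matrix.bfgsUpdate, IsHermitian, conjTranspose_eq_transpose_of_trivial, hT,
      transpose_vecMulVec]
  · set t := (s ⬝ᵥ B *ᵥ x) / (s ⬝ᵥ B *ᵥ s) with ht
    have hsx : x ⬝ᵥ B *ᵥ s = s ⬝ᵥ B *ᵥ x := hB.isHermitian.dotProduct_mulVec_comm x s
    have key : x ⬝ᵥ B.bfgsUpdate s y *ᵥ x =
        (x - t • s) ⬝ᵥ B *ᵥ (x - t • s) + (y ⬝ᵥ x) ^ 2 / (y ⬝ᵥ s) := by
      simp only [Matrix.bfgsUpdate, sub_mulVec, add_mulVec, smul_mulVec, vecMulVec_mulVec,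
        mulVec_sub, mulVec_smul, dotProduct_sub, dotProduct_add, sub_dotProduct, dotProduct_smul,
        smul_dotProduct, smul_eq_mul, op_smul_eq_smul, hsx, dotProduct_comm x y,
        dotProduct_comm (B *ᵥ s) x, ht]
      field_simp
      ring
    rw [star_trivial, key]
    by_cases hz : x - t • s = 0
    · have hxt : x = t • s := sub_eq_zero.1 hz
      have ht0 : t ≠ 0 := by
        intro h
        exact hx (by rw [hxt, h, zero_smul])
      have hyx : y ⬝ᵥ x ≠ 0 := by
        rw [hxt, dotProduct_smul, smul_eq_mul]
        exact mul_ne_zero ht0 hys.ne'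
      rw [hz, zero_dotProduct, zero_add]
      positivity
    · have := hB.dotProduct_mulVec_pos hz
      rw [star_trivial] at this
      positivity

lemma trace_bfgsUpdate_le {B : Matrix n n ℝ} (hB : B.PosSemidef) (s y : n → ℝ) :
    (B.bfgsUpdate s y).trace ≤ B.trace + (y ⬝ᵥ y) / (y ⬝ᵥ s) := by
  have hβ : 0 ≤ s ⬝ᵥ B *ᵥ s := by simpa using hB.dotProduct_mulVec_nonneg s
  have hBs : 0 ≤ B *ᵥ s ⬝ᵥ B *ᵥ s := by simpa using dotProduct_star_self_nonneg (B *ᵥ s)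
  have := mul_nonneg (inv_nonneg.2 hβ) hBs
  simp only [bfgsUpdate, trace_sub, trace_add, trace_smul, trace_vecMulVec, smul_eq_mul,
    div_eq_inv_mul]
  linarith

lemma det_bfgsUpdate [DecidableEq n] {B : Matrix n n ℝ} (hB : B.PosDef) {s y : n → ℝ} (hs : s ≠ 0)
    (hys : y ⬝ᵥ s ≠ 0) :
    (B.bfgsUpdate s y).det = B.det * ((s ⬝ᵥ y) / (s ⬝ᵥ B *ᵥ s)) := by
  have hβ : 0 < s ⬝ᵥ B *ᵥ s := by simpa using hB.dotProduct_mulVec_pos hs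
  set w := B⁻¹ *ᵥ y with hw
  have hBw : B *ᵥ w = y := by
    rw [hw, mulVec_mulVec, mul_nonsing_inv _ ((isUnit_iff_isUnit_det _).1 hB.isUnit), one_mulVec]
  have hsw : B *ᵥ s ⬝ᵥ w = s ⬝ᵥ y := by
    rw [dotProduct_comm, hB.isHermitian.dotProduct_mulVec_comm, hBw]
  let U : Matrix n (Fin 2) ℝ := (of ![w, s])ᵀ
  let V : Matrix (Fin 2) n ℝ := of ![(y ⬝ᵥ s)⁻¹ • y, -(s ⬝ᵥ B *ᵥ s)⁻¹ • (B *ᵥ s)]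
  have hUV : U * V = (y ⬝ᵥ s)⁻¹ • vecMulVec w y - (s ⬝ᵥ B *ᵥ s)⁻¹ • vecMulVec s (B *ᵥ s) := by
    ext i j
    simp [U, V, mul_apply, Fin.sum_univ_two, vecMulVec_apply]
    ring
  have hfac : B.bfgsUpdate s y = B * (1 + U * V) := by
    rw [hUV, mul_add, mul_one, mul_sub, Matrix.mul_smul, Matrix.mul_smul, mul_vecMulVec, mul_vecMulVec, hBw,
      bfgsUpdate, add_sub_assoc]
  have hVU (i j : Fin 2) : (V * U) i j =
      ![(y ⬝ᵥ s)⁻¹ • y, -(s ⬝ᵥ B *ᵥ s)⁻¹ • (B *ᵥ s)] i ⬝ᵥ ![w, s] j := rfl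
  rw [hfac, det_mul, det_one_add_mul_comm, det_fin_two]
  simp only [add_apply, hVU, cons_val_zero, cons_val_one, smul_dotProduct, smul_eq_mul, hsw,
    dotProduct_comm (B *ᵥ s) s, one_apply_eq, ne_eq, zero_ne_one, one_ne_zero, not_false_eq_true,
    one_apply_ne]
  rw [dotProduct_comm s y]
  field_simp
  ring

open scoped MatrixOrder in
lemma PosSemidef.dotProduct_mulVec_le_trace_mul {B : Matrix n n ℝ} (hB : B.PosSemidef)
    (x : n → ℝ) : x ⬝ᵥ B *ᵥ x ≤ B.trace * (x ⬝ᵥ x) := by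
  classical
  obtain ⟨C, rfl⟩ := CStarAlgebra.nonneg_iff_eq_star_mul_self.1 hB.nonneg
  rw [star_eq_conjTranspose, conjTranspose_eq_transpose_of_trivial, ← mulVec_mulVec, dotProduct_mulVec, vecMul_transpose,
    trace_mul_comm]
  simp only [trace, diag_apply, mul_apply, transpose_apply, Finset.sum_mul]
  refine Finset.sum_le_sum fun i _ => ?_
  simpa [dotProduct, mulVec, sq, Finset.sum_mul] using
    Finset.sum_mul_sq_le_sq_mul_sq Finset.univ (fun j => C i j) x

lemma PosSemidef.eigenvalues_le_trace [DecidableEq n] {B : Matrix n n ℝ} (hB : B.PosSemidef) (i : n) :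
    hB.isHermitian.eigenvalues i ≤ B.trace := by
  rw [hB.isHermitian.trace_eq_sum_eigenvalues]
  exact Finset.single_le_sum (f := hB.isHermitian.eigenvalues)
    (fun j _ => hB.eigenvalues_nonneg j) (Finset.mem_univ i)

lemma PosSemidef.det_le_eigenvalues_mul_pow [DecidableEq n] {B : Matrix n n ℝ} (hB : B.PosSemidef) {T : ℝ}
    (hT : B.trace ≤ T) (i : n) :
    B.det ≤ hB.isHermitian.eigenvalues i * T ^ (Fintype.card n - 1) := by
  rw [hB.isHermitian.det_eq_prod_eigenvalues,
    ← Finset.mul_prod_erase _ _ (Finset.mem_univ i)]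
  refine mul_le_mul_of_nonneg_left ?_ (hB.eigenvalues_nonneg i)
  calc ∏ j ∈ Finset.univ.erase i, hB.isHermitian.eigenvalues j
      ≤ ∏ _j ∈ Finset.univ.erase i, T :=
        Finset.prod_le_prod (fun j _ => hB.eigenvalues_nonneg j)
          fun j _ => (hB.eigenvalues_le_trace j).trans hT
    _ = T ^ (Fintype.card n - 1) := by
        rw [Finset.prod_const, Finset.card_erase_of_mem (Finset.mem_univ i), Finset.card_univ]

end Matrix

/-- Uniform eigenvalue bounds for the limited-memory damped BFGS recursion:
starting from `B₀ = γI` with `γ ∈ [δ, δ+A]`, performing `M` BFGS updates with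
step vectors `sᵢ ≠ 0` and damped gradient differences `ȳᵢ` satisfying the curvature
bound `sᵢᵀȳᵢ ≥ r γ ‖sᵢ‖²` and the ratio bound `(ȳᵢᵀȳᵢ)/(ȳᵢᵀsᵢ) ≤ (1/r)(A²/δ + (δ+A) + 2A)`,
every iterate is symmetric positive definite and every eigenvalue `μ` of `B_M` satisfies
`ã ≤ μ ≤ Ã` with `Ã = d(δ+A) + (M/r)(A²/δ + (δ+A) + 2A)` and
`ã = (r/Ã)^M δ^{d+M} / Ã^{d−1}`. -/
theorem lbfgs_eigenvalue_bounds (d M : ℕ) (hd : 0 < d) (hM : 0 < M)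
    (a A δ r γ : ℝ) (ha : 0 < a) (haA : a ≤ A) (hδ : 0 < δ)
    (hr0 : 0 < r) (hr1 : r < 1) (hγ : γ ∈ Set.Icc δ (δ + A))
    (s ybar : ℕ → Fin d → ℝ)
    (hs : ∀ i < M, s i ≠ 0)
    (hcurv : ∀ i < M, r * γ * (s i ⬝ᵥ s i) ≤ s i ⬝ᵥ ybar i)
    (hratio : ∀ i < M,
      (ybar i ⬝ᵥ ybar i) / (ybar i ⬝ᵥ s i) ≤ (1 / r) * (A ^ 2 / δ + (δ + A) + 2 * A))
    (B : ℕ → Matrix (Fin d) (Fin d) ℝ)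
    (hB0 : B 0 = γ • (1 : Matrix (Fin d) (Fin d) ℝ))
    (hBrec : ∀ i < M, B (i + 1) =
      B i + (ybar i ⬝ᵥ s i)⁻¹ • Matrix.vecMulVec (ybar i) (ybar i) -
        (s i ⬝ᵥ (B i).mulVec (s i))⁻¹ •
          Matrix.vecMulVec ((B i).mulVec (s i)) ((B i).mulVec (s i)))
    (Atil atil : ℝ)
    (hAtil : Atil = (d : ℝ) * (δ + A) + ((M : ℝ) / r) * (A ^ 2 / δ + (δ + A) + 2 * A))
    (hatil : atil = (r / Atil) ^ M * δ ^ (d + M) / Atil ^ (d - 1)) :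
    (∀ i ≤ M, (B i).PosDef) ∧ ∀ μ ∈ spectrum ℝ (B M), atil ≤ μ ∧ μ ≤ Atil := by
  obtain ⟨hγ1, hγ2⟩ := hγ
  have hA : 0 < A := ha.trans_le haA
  have hγ0 : 0 < γ := hδ.trans_le hγ1
  set R := (1 / r) * (A ^ 2 / δ + (δ + A) + 2 * A) with hR
  have hR0 : 0 < R := by positivity
  have hAR : Atil = d * (δ + A) + M * R := by rw [hAtil, hR]; ring
  have hd0 : (0 : ℝ) < d := by exact_mod_cast hd
  have hA0 : 0 < Atil := by rw [hAR]; positivity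
  have hss (i) (hi : i < M) : 0 < s i ⬝ᵥ s i := by
    simpa using dotProduct_star_self_pos_iff.2 (hs i hi)
  have hys (i) (hi : i < M) : 0 < ybar i ⬝ᵥ s i := by
    rw [dotProduct_comm]
    exact (mul_pos (mul_pos hr0 hγ0) (hss i hi)).trans_le (hcurv i hi)
  have hstep (i) (hi : i < M) : B (i + 1) = (B i).bfgsUpdate (s i) (ybar i) := hBrec i hi
  have hmain : ∀ i ≤ M, (B i).PosDef ∧ (B i).trace ≤ d * (δ + A) + i * R ∧
      (r * δ / Atil) ^ i * δ ^ d ≤ (B i).det := by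
    intro i
    induction i with
    | zero =>
      intro _
      rw [hB0]
      refine ⟨PosDef.one.smul hγ0, ?_, ?_⟩
      · simp only [trace_smul, trace_one, Fintype.card_fin, smul_eq_mul, Nat.cast_zero, zero_mul,
          add_zero]
        nlinarith
      · simp only [pow_zero, one_mul, det_smul, Fintype.card_fin, det_one, mul_one]
        gcongr
    | succ i ih =>
      intro hi
      obtain ⟨hpd, htr, hdet⟩ := ih (by lia)
      have hi' : i < M := hi
      rw [hstep i hi']
      refine ⟨hpd.bfgsUpdate (hs i hi') (hys i hi'), ?_, ?_⟩
      · have := trace_bfgsUpdate_le hpd.posSemidef (s i) (ybar i)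
        have := hratio i hi'
        push_cast
        linarith
      · have hβ : 0 < s i ⬝ᵥ B i *ᵥ s i := by simpa using hpd.dotProduct_mulVec_pos (hs i hi')
        have hiM : (i : ℝ) * R ≤ M * R := by gcongr
        have hβA : s i ⬝ᵥ B i *ᵥ s i ≤ Atil * (s i ⬝ᵥ s i) :=
          (hpd.posSemidef.dotProduct_mulVec_le_trace_mul (s i)).trans
            (mul_le_mul_of_nonneg_right (by linarith) (hss i hi').le)
        have hq : r * δ / Atil ≤ (s i ⬝ᵥ ybar i) / (s i ⬝ᵥ B i *ᵥ s i) := by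
          rw [div_le_div_iff₀ hA0 hβ]
          calc r * δ * (s i ⬝ᵥ B i *ᵥ s i) ≤ r * γ * (Atil * (s i ⬝ᵥ s i)) := by gcongr
            _ = r * γ * (s i ⬝ᵥ s i) * Atil := by ring
            _ ≤ (s i ⬝ᵥ ybar i) * Atil := by gcongr; exact hcurv i hi'
        rw [det_bfgsUpdate hpd (hs i hi') (hys i hi').ne', pow_succ, mul_right_comm]
        exact mul_le_mul hdet hq (by positivity) hpd.det_pos.le
  refine ⟨fun i hi => (hmain i hi).1, fun μ hμ => ?_⟩
  obtain ⟨hpd, htr, hdet⟩ := hmain M le_rfl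
  rw [← hAR] at htr
  rw [hpd.isHermitian.spectrum_real_eq_range_eigenvalues] at hμ
  obtain ⟨i, rfl⟩ := hμ
  refine ⟨?_, (hpd.posSemidef.eigenvalues_le_trace i).trans htr⟩
  have hprod := hpd.posSemidef.det_le_eigenvalues_mul_pow htr i
  rw [Fintype.card_fin] at hprod
  rw [hatil, div_le_iff₀ (by positivity)]
  calc (r / Atil) ^ M * δ ^ (d + M) = (r * δ / Atil) ^ M * δ ^ d := by
        rw [mul_div_right_comm, mul_pow, pow_add]; ring
    _ ≤ _ := hdet.trans hprod
end
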